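/- Let V be a finite type and let p, q : V → ℝ be probability mass functions on V (nonnegative, each summing to 1) with q x > 0 for every x and p ≠ q. Set β := ∑_{x ∈ V} min(p x, q x) (so β < 1) and define the residual distribution r x := (p x − min(p x, q x)) / (1 − β). Then r is a probability mass function on V (r x ≥ 0 for all x and ∑_{x ∈ V} r x = 1), and for every x ∈ V the output probability of speculative sampling equals the target probability: q x · min(1, p x / q x) + (1 − β) · r x = p x. (Lossless equivalence of single-step speculative sampling.) -/

import Mathlib

/-- Lossless equivalence of single-step speculative sampling: with target pmf `p`,
strictly positive draft pmf `q`, `p ≠ q`, acceptance mass `β = ∑ x, min(p x, q x)`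
(so `β < 1`), and residual distribution `r x = (p x − min(p x, q x)) / (1 − β)`,
the residual `r` is a pmf and the output probability of speculative sampling equals
the target probability: `q x · min(1, p x / q x) + (1 − β) · r x = p x` for all `x`. -/
theorem speculative_sampling_lossless
    {V : Type*} [Fintype V] (p q : V → ℝ)
    (hp0 : ∀ x, 0 ≤ p x) (hp1 : ∑ x, p x = 1)
    (hq0 : ∀ x, 0 < q x) (hq1 : ∑ x, q x = 1)
    (hpq : p ≠ q)
    (β : ℝ) (hβ : β = ∑ x, min (p x) (q x))
    (r : V → ℝ) (hr : ∀ x, r x = (p x - min (p x) (q x)) / (1 - β)) :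
    β < 1 ∧ (∀ x, 0 ≤ r x) ∧ (∑ x, r x = 1) ∧
      ∀ x, q x * min 1 (p x / q x) + (1 - β) * r x = p x := by
  have hβ1 : β < 1 := by
    obtain ⟨x, hx⟩ : ∃ x, q x < p x := by
      by_contra! hle
      have heq := (Finset.sum_eq_sum_iff_of_le fun x _ => hle x).1 (hp1.trans hq1.symm)
      exact hpq (funext fun x => heq x (Finset.mem_univ x))
    rw [hβ, ← hp1]
    exact Finset.sum_lt_sum (fun y _ => min_le_left _ _)
      ⟨x, Finset.mem_univ x, min_lt_of_right_lt hx⟩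
  have hpos : 0 < 1 - β := sub_pos.2 hβ1
  refine ⟨hβ1, fun x => ?_, ?_, fun x => ?_⟩
  · rw [hr]
    exact div_nonneg (sub_nonneg.2 (min_le_left _ _)) hpos.le
  · simp only [hr]
    rw [← Finset.sum_div, Finset.sum_sub_distrib, hp1, ← hβ, div_self hpos.ne']
  · rw [hr, mul_div_cancel₀ _ hpos.ne', mul_min_of_nonneg _ _ (hq0 x).le, mul_one,
      mul_div_cancel₀ _ (hq0 x).ne', min_comm, add_sub_cancel]
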